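/- Let λ ≥ 0 and let Z be a random variable with the Poisson distribution of parameter λ. Let f : ℕ → ℝ be a bounded function. Then for every n ∈ ℕ, E[f(Z) · Z^n] = ∑_{k=0}^n λ^k · S(n,k) · E[f(Z+k)], where S(n,k) denotes the Stirling number of the second kind. -/

import Mathlib

open MeasureTheory Finset

/-- Stirling number of the second kind: the number of partitions of a set of `n`
elements into `k` non-empty subsets. -/
noncomputable def stirling2 (n k : ℕ) : ℕ :=
  Nat.card {P : Finpartition (Finset.univ : Finset (Fin n)) // P.parts.card = k}

/-- A map out of a finite type amounts to a partition of its domain into fibres, together with an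
injective choice of a value for each fibre. -/
theorem bijective_finpartition_sigma_embedding {α β : Type*} [Fintype α] [DecidableEq α] :
    Function.Bijective
      (fun (x : Σ P : Finpartition (Finset.univ : Finset α), (P.parts ↪ β)) (a : α) =>
        x.2 ⟨x.1.part a, x.1.part_mem.2 (mem_univ a)⟩) := by
  classical
  constructor
  · rintro ⟨P, g⟩ ⟨Q, h⟩ hgh
    have hval : ∀ a, g ⟨P.part a, P.part_mem.2 (mem_univ a)⟩ =
        h ⟨Q.part a, Q.part_mem.2 (mem_univ a)⟩ := congrFun hgh
    have hiff : ∀ a b, P.part a = P.part b ↔ Q.part a = Q.part b := fun a b => by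
      have hP : P.part a = P.part b ↔ g ⟨P.part a, P.part_mem.2 (mem_univ a)⟩ =
          g ⟨P.part b, P.part_mem.2 (mem_univ b)⟩ := by simp
      have hQ : Q.part a = Q.part b ↔ h ⟨Q.part a, Q.part_mem.2 (mem_univ a)⟩ =
          h ⟨Q.part b, Q.part_mem.2 (mem_univ b)⟩ := by simp
      rw [hP, hQ, hval, hval]
    have hpart : ∀ a, P.part a = Q.part a := fun a => by
      ext b
      rw [P.mem_part_iff_part_eq_part (mem_univ b) (mem_univ a),
        Q.mem_part_iff_part_eq_part (mem_univ b) (mem_univ a), hiff]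
    have hPQ : P = Q := by
      ext s
      constructor
      · intro hs
        obtain ⟨a, ha⟩ := P.nonempty_of_mem_parts hs
        rw [← P.part_eq_of_mem hs ha, hpart]
        exact Q.part_mem.2 (mem_univ a)
      · intro hs
        obtain ⟨a, ha⟩ := Q.nonempty_of_mem_parts hs
        rw [← Q.part_eq_of_mem hs ha, ← hpart]
        exact P.part_mem.2 (mem_univ a)
    subst hPQ
    congr 1
    ext ⟨s, hs⟩
    obtain ⟨a, ha⟩ := P.nonempty_of_mem_parts hs
    have := hval a
    simpa only [P.part_eq_of_mem hs ha] using this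
  · intro f
    let P : Finpartition (Finset.univ : Finset α) := Finpartition.ofSetoid (Setoid.ker f)
    have hP : ∀ {a b}, b ∈ P.part a ↔ f a = f b := fun {a b} =>
      Finpartition.mem_part_ofSetoid_iff_rel
    have hne : ∀ s : P.parts, ∃ a, a ∈ s.1 := fun s => P.nonempty_of_mem_parts s.2
    choose r hr using hne
    have hpart : ∀ s, P.part (r s) = s.1 := fun s => P.part_eq_of_mem s.2 (hr s)
    refine ⟨⟨P, ⟨fun s => f (r s), fun s t hst => ?_⟩⟩, ?_⟩
    · have hmem : r t ∈ P.part (r s) := hP.2 hst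
      rw [hpart] at hmem
      exact Subtype.ext ((P.part_eq_of_mem s.2 hmem).symm.trans (hpart t))
    · funext a
      exact (hP.1 (hr ⟨P.part a, P.part_mem.2 (mem_univ a)⟩)).symm

theorem pow_eq_sum_stirling2_mul_descFactorial (m n : ℕ) :
    m ^ n = ∑ k ∈ Finset.range (n + 1), stirling2 n k * m.descFactorial k := by
  classical
  calc m ^ n = Nat.card (Fin n → Fin m) := by simp
    _ = ∑ P : Finpartition (Finset.univ : Finset (Fin n)), m.descFactorial P.parts.card := by
      rw [← Nat.card_eq_of_bijective _
        (bijective_finpartition_sigma_embedding (α := Fin n) (β := Fin m)), Nat.card_sigma]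
      simp [Nat.card_eq_fintype_card, Fintype.card_embedding_eq]
    _ = ∑ k ∈ Finset.range (n + 1),
        ∑ P : Finpartition (Finset.univ : Finset (Fin n)) with P.parts.card = k,
          m.descFactorial P.parts.card := by
      refine (sum_fiberwise_of_maps_to (fun P _ => ?_) _).symm
      simpa [Nat.lt_succ_iff] using P.card_parts_le_card
    _ = _ := by
      refine sum_congr rfl fun k _ => ?_
      rw [sum_congr rfl fun P hP => by rw [(mem_filter.1 hP).2], sum_const, smul_eq_mul,
        stirling2, Nat.card_eq_fintype_card, Fintype.card_subtype]

theorem hasSum_poisson_descFactorial_mul (lam : ℝ) {f : ℕ → ℝ} (hf : ∃ C, ∀ m, |f m| ≤ C)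
    (k : ℕ) :
    HasSum (fun m : ℕ => Real.exp (-lam) * lam ^ m / m.factorial * (m.descFactorial k * f m))
      (lam ^ k * ∑' m : ℕ, Real.exp (-lam) * lam ^ m / m.factorial * f (m + k)) := by
  obtain ⟨C, hC⟩ := hf
  have hsum : Summable fun m : ℕ => Real.exp (-lam) * lam ^ m / m.factorial * f (m + k) := by
    refine Summable.of_norm_bounded
      (((Real.summable_pow_div_factorial lam).norm.mul_left (Real.exp (-lam))).mul_right C)
      fun m => ?_
    rw [norm_mul, mul_div_assoc, norm_mul, Real.norm_of_nonneg (Real.exp_pos _).le]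
    exact mul_le_mul_of_nonneg_left (hC _) (by positivity)
  have hzero : ∑ m ∈ Finset.range k,
      Real.exp (-lam) * lam ^ m / m.factorial * (m.descFactorial k * f m) = 0 :=
    sum_eq_zero fun m hm => by
      simp [Nat.descFactorial_eq_zero_iff_lt.2 (mem_range.1 hm)]
  rw [← add_zero (lam ^ k * _), ← hzero, ← hasSum_nat_add_iff k]
  convert! hsum.hasSum.mul_left (lam ^ k) using 2 with m
  have hfac : ((m + k).factorial : ℝ) = m.factorial * (m + k).descFactorial k := by
    have := Nat.factorial_mul_descFactorial (Nat.le_add_left k m)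
    rw [Nat.add_sub_cancel] at this
    exact_mod_cast this.symm
  have hm : (m.factorial : ℝ) ≠ 0 := by positivity
  have hd : ((m + k).descFactorial k : ℝ) ≠ 0 := by
    rw [Nat.cast_ne_zero, Ne, Nat.descFactorial_eq_zero_iff_lt]
    omega
  rw [hfac]
  field_simp
  ring

theorem integral_comp_eq_tsum_poisson {Ω : Type*} [MeasurableSpace Ω] {μ : Measure Ω}
    {lam : ℝ} (hlam : 0 ≤ lam) {Z : Ω → ℕ} (hZ : Measurable Z)
    (hdist : ∀ m : ℕ, μ {ω | Z ω = m} =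
      ENNReal.ofReal (Real.exp (-lam) * lam ^ m / Nat.factorial m)) (g : ℕ → ℝ) :
    ∫ ω, g (Z ω) ∂μ = ∑' m : ℕ, Real.exp (-lam) * lam ^ m / m.factorial * g m := by
  lift lam to NNReal using hlam
  have hmap : μ.map Z = ProbabilityTheory.poissonMeasure lam := by
    refine Measure.ext_of_singleton fun m => ?_
    rw [Measure.map_apply hZ (measurableSet_singleton m),
      ProbabilityTheory.poissonMeasure_singleton]
    exact hdist m
  rw [← integral_map hZ.aemeasurable (.of_discrete), hmap,
    ProbabilityTheory.integral_poissonMeasure]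
  simp

theorem stmt1 {Ω : Type*} [MeasurableSpace Ω] (μ : Measure Ω) [IsProbabilityMeasure μ]
    (lam : ℝ) (hlam : 0 ≤ lam) (Z : Ω → ℕ) (hZ : Measurable Z)
    (hdist : ∀ m : ℕ, μ {ω | Z ω = m} =
      ENNReal.ofReal (Real.exp (-lam) * lam ^ m / Nat.factorial m))
    (f : ℕ → ℝ) (hf : ∃ C, ∀ m, |f m| ≤ C) (n : ℕ) :
    ∫ ω, f (Z ω) * (Z ω : ℝ) ^ n ∂μ =
      ∑ k ∈ Finset.range (n + 1),
        lam ^ k * (stirling2 n k : ℝ) * ∫ ω, f (Z ω + k) ∂μ := by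
  rw [integral_comp_eq_tsum_poisson hlam hZ hdist fun m => f m * (m : ℝ) ^ n]
  have hsum := hasSum_sum (s := Finset.range (n + 1)) fun k _ =>
    (hasSum_poisson_descFactorial_mul lam hf k).mul_left (stirling2 n k : ℝ)
  convert! hsum.tsum_eq using 1
  · refine tsum_congr fun m => ?_
    have hpow : (m : ℝ) ^ n =
        ∑ k ∈ Finset.range (n + 1), (stirling2 n k : ℝ) * m.descFactorial k := by
      exact_mod_cast pow_eq_sum_stirling2_mul_descFactorial m n
    rw [hpow, mul_sum, mul_sum]
    exact sum_congr rfl fun k _ => by ring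
  · refine sum_congr rfl fun k _ => ?_
    rw [integral_comp_eq_tsum_poisson hlam hZ hdist fun m => f (m + k)]
    ring
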